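/- Let F be a field of characteristic p > 0 (respectively 0) and G a group having a subgroup A of finite index m such that the commutator subgroup [A,A] is a finite p-group of order p^k (respectively trivial). Then the group algebra F[G] satisfies a nontrivial polynomial identity; in fact in the abelian case F[G] satisfies s_{2m} = 0 after embedding into M_m(F[A]), and in the p-abelian case F[A] satisfies ([x,y])^{p^k} = 0. -/

import Mathlib

open Polynomial in
theorem PI_derivative_charpoly {n C : Type*} [Fintype n] [DecidableEq n] [CommRing C]
    (Y : Matrix n n C) :
    derivative Y.charpoly = (Matrix.adjugate Y.charmatrix).trace := by
  have h1 : ∀ i : n, (Matrix.adjugate Y.charmatrix) i i =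
      ∑ σ : Equiv.Perm n, (Equiv.Perm.sign σ : ℤ) •
        ((∏ j ∈ Finset.univ.erase i, Y.charmatrix (σ j) j) * derivative (Y.charmatrix (σ i) i)) := by
    intro i
    have e : (Matrix.adjugate Y.charmatrix) i i =
        (Y.charmatrix.updateCol i (Pi.single i 1)).det := by
      rw [← Matrix.cramer_apply, Matrix.cramer_eq_adjugate_mulVec]
      simp
    rw [e, Matrix.det_apply]
    refine Finset.sum_congr rfl fun σ _ => ?_
    rw [← Finset.prod_erase_mul _ _ (Finset.mem_univ i)]
    have e2 : derivative (Y.charmatrix (σ i) i) =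
        (Y.charmatrix.updateCol i (Pi.single i 1)) (σ i) i := by
      rw [Matrix.updateCol_self, Matrix.charmatrix_apply, Matrix.diagonal_apply, Pi.single_apply]
      split_ifs <;> simp
    rw [e2]
    congr 2
    refine Finset.prod_congr rfl fun j hj => ?_
    rw [Matrix.updateCol_ne (Finset.ne_of_mem_erase hj)]
  rw [Matrix.trace]
  simp only [Matrix.diag_apply, h1]
  rw [Finset.sum_comm, Matrix.charpoly, Matrix.det_apply, map_sum]
  refine Finset.sum_congr rfl fun σ _ => ?_
  rw [← Finset.smul_sum, ← Polynomial.derivative_prod_finset]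
  rw [Units.smul_def, map_zsmul]

open Polynomial in
theorem PI_pow_eq_zero {n C : Type*} [Fintype n] [DecidableEq n] [CommRing C] [Algebra ℚ C]
    (Y : Matrix n n C) (h : ∀ k, (Y ^ (k + 1)).trace = 0) : Y ^ Fintype.card n = 0 := by
  nontriviality C
  set B := Matrix.adjugate Y.charmatrix with hB
  set Z : Matrix n n C[X] := Y.map Polynomial.C with hZ
  have hZpow : ∀ l, Z ^ l = (Y ^ l).map Polynomial.C := by
    intro l
    rw [hZ]
    exact (map_pow (RingHom.mapMatrix (Polynomial.C : C →+* C[X])) Y l).symm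
  have hBZ : (X : C[X]) • B = B * Z + Y.charpoly • (1 : Matrix n n C[X]) := by
    have := Matrix.adjugate_mul Y.charmatrix
    rw [← Matrix.charpoly, ← hB, Matrix.charmatrix, mul_sub] at this
    rw [← this, Matrix.scalar_apply, ← Matrix.smul_one_eq_diagonal]
    simp [hZ]
  have hT : ∀ l, (X : C[X]) * (B * Z ^ l).trace =
      (B * Z ^ (l+1)).trace + Y.charpoly * (Z ^ l).trace := by
    intro l
    have := congrArg (fun M => (M * Z ^ l).trace) hBZ
    simpa [add_mul, mul_assoc, ← pow_succ', Matrix.trace_add, Matrix.trace_smul] using this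
  have htr : ∀ l, (Z ^ (l+1)).trace = 0 := by
    intro l
    rw [hZpow]
    have := (AddMonoidHom.map_trace (Polynomial.C : C →+* C[X]).toAddMonoidHom (Y ^ (l+1))).symm
    simpa [h] using this
  have hT2 : ∀ l, (B * Z ^ (l+1)).trace = X ^ l * (B * Z ^ 1).trace := by
    intro l
    induction l with
    | zero => simp
    | succ l ih =>
      have := hT (l+1)
      rw [htr, mul_zero, add_zero] at this
      rw [← this, ih]; ring
  have hdeg : ∃ D : ℕ, ∀ i j, (B i j).natDegree ≤ D := by
    refine ⟨∑ i, ∑ j, (B i j).natDegree, fun i j => ?_⟩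
    calc (B i j).natDegree ≤ ∑ j, (B i j).natDegree :=
          Finset.single_le_sum (f := fun j => (B i j).natDegree) (by simp) (Finset.mem_univ j)
      _ ≤ _ := Finset.single_le_sum (f := fun i => ∑ j, (B i j).natDegree) (by simp) (Finset.mem_univ i)
  obtain ⟨D, hD⟩ := hdeg
  have hT3 : (B * Z ^ 1).trace = 0 := by
    ext j
    have h1 := hT2 (D + 1)
    have h2 := congrArg (fun q => q.coeff (j + (D + 1))) h1
    simp only [Polynomial.coeff_X_pow_mul] at h2
    rw [← h2, hZpow, Matrix.trace]
    simp only [Matrix.diag_apply, Matrix.mul_apply, Matrix.map_apply, Polynomial.finsetSum_coeff,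
      Polynomial.coeff_mul_C, Polynomial.coeff_zero]
    refine Finset.sum_eq_zero fun a _ => Finset.sum_eq_zero fun b _ => ?_
    rw [Polynomial.coeff_eq_zero_of_natDegree_lt, zero_mul]
    have := hD a b
    omega
  have hfin : (X : C[X]) * derivative Y.charpoly = Y.charpoly * (Fintype.card n : C[X]) := by
    have := hT 0
    rw [zero_add, hT3, pow_zero, mul_one, Matrix.trace_one, zero_add, hB,
      ← PI_derivative_charpoly] at this
    exact this
  have hp : Y.charpoly = X ^ Fintype.card n := by
    ext k
    rw [Polynomial.coeff_X_pow]
    split_ifs with hk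
    · subst hk
      have := Y.charpoly_monic
      rw [Polynomial.Monic, Polynomial.leadingCoeff, Matrix.charpoly_natDegree_eq_dim] at this
      exact this
    · have h2 := congrArg (fun q => q.coeff k) hfin
      have h3 : (k : C) * Y.charpoly.coeff k = Fintype.card n * Y.charpoly.coeff k := by
        cases k with
        | zero => simpa [mul_comm] using h2
        | succ k =>
          simp only [Polynomial.coeff_X_mul, Polynomial.coeff_derivative,
            Polynomial.coeff_mul_natCast] at h2
          push_cast
          rw [mul_comm, h2, mul_comm]
      have h4 : ((k : ℚ) - Fintype.card n) • Y.charpoly.coeff k = 0 := by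
        rw [Algebra.smul_def]
        simp [sub_mul, h3]
      have hne : ((k : ℚ) - Fintype.card n) ≠ 0 := by
        rw [sub_ne_zero]; exact_mod_cast hk
      have h5 := congrArg (fun x => ((k : ℚ) - Fintype.card n)⁻¹ • x) h4
      simpa [smul_smul, inv_mul_cancel₀ hne] using h5
  have := Matrix.aeval_self_charpoly Y
  rwa [hp, map_pow, aeval_X] at this
/-- The standard polynomial evaluated at `h`. -/
def PIstd {R : Type*} [Ring R] {N : ℕ} (h : Fin N → R) : R :=
  ∑ σ : Equiv.Perm (Fin N), (Equiv.Perm.sign σ : ℤ) • (List.ofFn fun i => h (σ i)).prod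

theorem PIstd_map {R S : Type*} [Ring R] [Ring S] (φ : R →+* S) {N : ℕ} (h : Fin N → R) :
    φ (PIstd h) = PIstd (fun i => φ (h i)) := by
  simp only [PIstd, map_sum, map_zsmul, map_list_prod, List.map_ofFn]
  rfl

section Rosset
variable {n : Type*} [Fintype n] [DecidableEq n] {N : ℕ}

/-- generators of the exterior algebra -/
noncomputable def PIe (N : ℕ) (i : Fin N) : ExteriorAlgebra ℚ (Fin N → ℚ) :=
  ExteriorAlgebra.ι ℚ (Pi.single i 1)

theorem PIe_anti (i j : Fin N) : PIe N i * PIe N j = - (PIe N j * PIe N i) :=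
  eq_neg_of_add_eq_zero_left (ExteriorAlgebra.ι_add_mul_swap _ _)

theorem PIe_central (i j : Fin N) :
    PIe N i * PIe N j ∈ Subalgebra.center ℚ (ExteriorAlgebra ℚ (Fin N → ℚ)) := by
  rw [Subalgebra.mem_center_iff]
  intro b
  induction b using ExteriorAlgebra.induction with
  | algebraMap r => exact Algebra.commutes _ _
  | ι x =>
    have h1 : ∀ k, ExteriorAlgebra.ι ℚ x * PIe N k = - (PIe N k * ExteriorAlgebra.ι ℚ x) :=
      fun k => eq_neg_of_add_eq_zero_left (ExteriorAlgebra.ι_add_mul_swap _ _)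
    rw [← mul_assoc, h1, neg_mul, mul_assoc, h1, mul_neg, neg_neg, mul_assoc]
  | mul a b ha hb => rw [mul_assoc, hb, ← mul_assoc, ha, mul_assoc]
  | add a b ha hb => rw [add_mul, ha, hb, mul_add]

/-- component of the generic matrix -/
noncomputable def PIM (A : Fin N → Matrix n n ℚ) (i : Fin N) :
    Matrix n n (ExteriorAlgebra ℚ (Fin N → ℚ)) :=
  Matrix.of fun a b => A i a b • PIe N i

theorem PIM_prod (A : Fin N → Matrix n n ℚ) (l : List (Fin N)) (a b : n) :
    (l.map (PIM A)).prod a b = (l.map A).prod a b • (l.map (PIe N)).prod := by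
  induction l generalizing a with
  | nil => simp [Matrix.one_apply]
  | cons i l ih =>
    simp only [List.map_cons, List.prod_cons, Matrix.mul_apply, ih, Finset.sum_smul]
    refine Finset.sum_congr rfl fun c _ => ?_
    simp [PIM, smul_smul, mul_comm]

/-- The generic odd matrix. -/
noncomputable def PIX (A : Fin N → Matrix n n ℚ) : Matrix n n (ExteriorAlgebra ℚ (Fin N → ℚ)) :=
  ∑ i, PIM A i

theorem PIX_apply (A : Fin N → Matrix n n ℚ) (a b : n) :
    PIX A a b = ∑ i, A i a b • PIe N i := by
  simp [PIX, PIM, Matrix.sum_apply]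

theorem PIX_anti (A : Fin N → Matrix n n ℚ) (a b c d : n) :
    PIX A a b * PIX A c d = - (PIX A c d * PIX A a b) := by
  simp only [PIX_apply, Finset.sum_mul, Finset.mul_sum]
  rw [Finset.sum_comm, ← Finset.sum_neg_distrib]
  refine Finset.sum_congr rfl fun i _ => ?_
  rw [← Finset.sum_neg_distrib]
  refine Finset.sum_congr rfl fun j _ => ?_
  rw [smul_mul_smul_comm, smul_mul_smul_comm, PIe_anti j i, smul_neg, neg_neg, mul_comm]

theorem PIX_sq (A : Fin N → Matrix n n ℚ) (a b : n) :
    (PIX A * PIX A) a b ∈ Subalgebra.center ℚ (ExteriorAlgebra ℚ (Fin N → ℚ)) := by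
  simp only [Matrix.mul_apply, PIX_apply, Finset.sum_mul, Finset.mul_sum]
  refine Subalgebra.sum_mem _ fun _ _ => Subalgebra.sum_mem _ fun _ _ =>
    Subalgebra.sum_mem _ fun _ _ => ?_
  rw [smul_mul_smul_comm]
  exact Subalgebra.smul_mem _ (PIe_central _ _) _

theorem PIX_pow (A : Fin N → Matrix n n ℚ) : PIX A ^ (2 * Fintype.card n) = 0 := by
  let C := Subalgebra.center ℚ (ExteriorAlgebra ℚ (Fin N → ℚ))
  let Y : Matrix n n C := Matrix.of fun a b => ⟨(PIX A * PIX A) a b, PIX_sq A a b⟩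
  let φ : C →+* ExteriorAlgebra ℚ (Fin N → ℚ) := C.val.toRingHom
  have hφ : Function.Injective φ := Subtype.val_injective
  have hY : φ.mapMatrix Y = PIX A * PIX A := by
    ext a b; rfl
  have hYk : ∀ k, φ.mapMatrix (Y ^ k) = (PIX A * PIX A) ^ k := fun k => by
    rw [map_pow, hY]
  have htr : ∀ k, (Y ^ (k + 1)).trace = 0 := by
    intro k
    apply hφ
    have e1 : φ (Y ^ (k + 1)).trace = (φ.mapMatrix (Y ^ (k+1))).trace :=
      AddMonoidHom.map_trace φ.toAddMonoidHom (Y ^ (k+1))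
    rw [e1, hYk, map_zero]
    set Z := PIX A * (PIX A * PIX A) ^ k with hZ
    have h1 : (PIX A * PIX A) ^ (k + 1) = PIX A * Z := by
      rw [hZ, pow_succ', mul_assoc]
    have h2 : PIX A * Z = Z * PIX A := by
      have : Commute (PIX A) ((PIX A * PIX A) ^ k) :=
        ((Commute.refl _).mul_right (Commute.refl _)).pow_right k
      rw [hZ, mul_assoc, ← this.eq]
    have h3 : (PIX A * Z).trace = - (Z * PIX A).trace := by
      simp only [Matrix.trace, Matrix.diag_apply, Matrix.mul_apply]
      rw [Finset.sum_comm, ← Finset.sum_neg_distrib]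
      refine Finset.sum_congr rfl fun b _ => ?_
      rw [← Finset.sum_neg_distrib]
      refine Finset.sum_congr rfl fun a _ => ?_
      rw [hZ, Matrix.mul_apply, Finset.mul_sum, Finset.sum_mul, ← Finset.sum_neg_distrib]
      refine Finset.sum_congr rfl fun c _ => ?_
      have hc : ((PIX A * PIX A) ^ k) c a ∈ C := by
        rw [← hYk]; exact ((Y ^ k) c a).2
      have hc2 := (Subalgebra.mem_center_iff.1 hc) (PIX A a b)
      rw [← mul_assoc, PIX_anti, neg_mul, mul_assoc, hc2, mul_assoc]
    rw [← h2] at h3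
    rw [h1]
    have h4 : (2 : ℚ) • (PIX A * Z).trace = 0 := by
      rw [two_smul]; nth_rw 1 [h3]; simp
    have h5 := congrArg (fun x => (2⁻¹ : ℚ) • x) h4
    simpa [smul_smul] using h5
  have h := PI_pow_eq_zero Y htr
  rw [pow_mul, pow_two, ← hYk, h, map_zero]

theorem PI_AL_rat (A : Fin (2 * Fintype.card n) → Matrix n n ℚ) : PIstd A = 0 := by
  generalize hN : 2 * Fintype.card n = N at A
  have hX := PIX_pow A
  rw [hN] at hX
  have e1 : PIX A ^ N = ∑ f : Fin N → Fin N, ((List.ofFn f).map (PIM A)).prod := by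
    have := (MultilinearMap.mkPiAlgebraFin ℚ N
      (Matrix n n (ExteriorAlgebra ℚ (Fin N → ℚ)))).map_sum (fun (_ : Fin N) (j : Fin N) => PIM A j)
    simp only [MultilinearMap.mkPiAlgebraFin_apply] at this
    simp only [List.map_ofFn]
    refine Eq.trans ?_ this
    simp [PIX]
  let L : ExteriorAlgebra ℚ (Fin N → ℚ) →ₗ[ℚ] ℚ :=
    ExteriorAlgebra.liftAlternating (Pi.single N Matrix.detRowAlternating)
  have hL : ∀ f : Fin N → Fin N, L ((List.ofFn f).map (PIe N)).prod =
      Matrix.det (Matrix.of fun j => (Pi.single (f j) 1 : Fin N → ℚ)) := by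
    intro f
    have : ((List.ofFn f).map (PIe N)).prod =
        ExteriorAlgebra.ιMulti ℚ N (fun j => (Pi.single (f j) 1 : Fin N → ℚ)) := by
      rw [ExteriorAlgebra.ιMulti_apply, List.map_ofFn]; rfl
    rw [this, ExteriorAlgebra.liftAlternating_apply_ιMulti, Pi.single_eq_same]
    rfl
  ext a b
  have h1 := congrArg (fun M => L (M a b)) hX
  simp only [e1, Matrix.sum_apply, map_sum, PIM_prod, map_smul, hL, Matrix.zero_apply, map_zero] at h1
  rw [Matrix.zero_apply, ← h1, PIstd, Matrix.sum_apply]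
  simp_rw [← Matrix.det_transpose (Matrix.of _), Matrix.det_apply, Finset.smul_sum]
  rw [Finset.sum_comm]
  refine Finset.sum_congr rfl fun σ _ => ?_
  rw [Finset.sum_eq_single (σ : Fin N → Fin N)]
  · simp [List.map_ofFn, Units.smul_def, Function.comp_def, mul_comm]
  · intro f _ hf
    obtain ⟨j, hj⟩ := Function.ne_iff.1 hf
    rw [Finset.prod_eq_zero (Finset.mem_univ j)]
    · simp
    · simp [hj.symm]
  · simp

theorem PI_AL {R : Type*} [CommRing R] (A : Fin (2 * Fintype.card n) → Matrix n n R) :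
    PIstd A = 0 := by
  generalize hN : 2 * Fintype.card n = N at A
  let T : MultilinearMap R (fun _ : Fin N => Matrix n n R) (Matrix n n R) :=
    ∑ σ : Equiv.Perm (Fin N), (Equiv.Perm.sign σ : ℤ) •
      (MultilinearMap.mkPiAlgebraFin R N (Matrix n n R)).domDomCongr σ
  have hT : ∀ h, T h = PIstd h := by
    intro h
    simp [T, PIstd]
  have hT0 : T = 0 := by
    refine Module.Basis.ext_multilinear (fun _ => Matrix.stdBasis R n n) fun v => ?_
    rw [hT, zero_apply]
    have hZ : PIstd (fun i : Fin N => Matrix.single (v i).1 (v i).2 (1 : ℤ)) = 0 := by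
      have hinj : Function.Injective ((Int.castRingHom ℚ).mapMatrix (m := n)) :=
        Matrix.map_injective Int.cast_injective
      apply hinj
      rw [PIstd_map, map_zero]
      subst hN
      exact PI_AL_rat _
    have := congrArg (Int.castRingHom R).mapMatrix hZ
    rw [PIstd_map, map_zero] at this
    rw [← this]
    congr 1
    ext i : 1
    rw [Matrix.stdBasis_eq_single]
    ext a b
    simp [Matrix.single_apply]
  rw [← hT, hT0]; rfl
end Rosset
section Embed
variable (F : Type*) [Field F] {G : Type*} [Group G] (A : Subgroup G)

open Classical in
/-- matrix entries of the induced representation -/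
noncomputable def PIent (g : G) (q r : G ⧸ A) : MonoidAlgebra F A :=
  if h : (q.out)⁻¹ * g * r.out ∈ A then MonoidAlgebra.single ⟨_, h⟩ 1 else 0

theorem PI_mem_iff (g : G) (q r : G ⧸ A) :
    (q.out)⁻¹ * g * r.out ∈ A ↔ q = ((g * r.out : G) : G ⧸ A) := by
  rw [mul_assoc, ← QuotientGroup.eq, QuotientGroup.out_eq']

variable [Fintype (G ⧸ A)] [DecidableEq (G ⧸ A)]

/-- the monomial representation -/
noncomputable def PIrep : G →* Matrix (G ⧸ A) (G ⧸ A) (MonoidAlgebra F A) where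
  toFun g := Matrix.of fun q r => PIent F A g q r
  map_one' := by
    ext1 q r
    rw [Matrix.of_apply, Matrix.one_apply, PIent]
    have := PI_mem_iff A 1 q r
    rw [one_mul, QuotientGroup.out_eq'] at this
    split_ifs with h1 h2 h2
    · subst h2
      rw [MonoidAlgebra.one_def]
      congr 1
      ext; simp
    · exact absurd (this.1 h1) h2
    · exact absurd (this.2 h2) h1
    · rfl
  map_mul' g g' := by
    ext1 q r
    rw [Matrix.mul_apply]
    simp only [Matrix.of_apply]
    rw [Finset.sum_eq_single (((g' * r.out : G) : G ⧸ A))]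
    · set s : G ⧸ A := ((g' * r.out : G) : G ⧸ A) with hs
      have h1 : (s.out)⁻¹ * g' * r.out ∈ A := (PI_mem_iff A g' s r).2 hs
      have key : (q.out)⁻¹ * (g * g') * r.out =
          ((q.out)⁻¹ * g * s.out) * ((s.out)⁻¹ * g' * r.out) := by group
      have h2 : (q.out)⁻¹ * (g * g') * r.out ∈ A ↔ (q.out)⁻¹ * g * s.out ∈ A := by
        rw [key]; exact Subgroup.mul_mem_cancel_right A h1
      unfold PIent
      by_cases h3 : (q.out)⁻¹ * g * s.out ∈ A
      · rw [dif_pos (h2.2 h3), dif_pos h3, dif_pos h1, MonoidAlgebra.single_mul_single, mul_one]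
        congr 1
        ext1
        exact key
      · rw [dif_neg (fun h => h3 (h2.1 h)), dif_neg h3, zero_mul]
    · intro s _ hs
      have : PIent F A g' s r = 0 := by
        unfold PIent
        rw [dif_neg]
        rw [PI_mem_iff]; exact hs
      rw [this, mul_zero]
    · simp

/-- the embedding of the group algebra in a matrix algebra -/
noncomputable def PIemb : MonoidAlgebra F G →ₐ[F] Matrix (G ⧸ A) (G ⧸ A) (MonoidAlgebra F A) :=
  MonoidAlgebra.lift F _ G (PIrep F A)

theorem PIemb_coeff (x : MonoidAlgebra F G) (q r : G ⧸ A) (a : A) :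
    (PIemb F A x q r).coeff a = x.coeff (q.out * a * (r.out)⁻¹) := by
  induction x using MonoidAlgebra.induction_linear with
  | zero => simp
  | add x y hx hy => simp [hx, hy]
  | single g c =>
    classical
    rw [PIemb, MonoidAlgebra.lift_single, Matrix.smul_apply, MonoidAlgebra.coeff_smul_apply]
    change c • (PIent F A g q r).coeff a = _
    rw [MonoidAlgebra.coeff_single, Finsupp.single_apply]
    unfold PIent
    have key : g = q.out * a * (r.out)⁻¹ ↔ (q.out)⁻¹ * g * r.out = a := by
      constructor
      · rintro rfl; group
      · intro h; rw [← h]; group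
    split_ifs with h1 h2 h2
    · rw [MonoidAlgebra.coeff_single, Finsupp.single_apply, if_pos]
      · simp
      · ext1; exact key.1 h2
    · rw [MonoidAlgebra.coeff_single, Finsupp.single_apply, if_neg]
      · simp
      · intro h; exact h2 (key.2 (congrArg Subtype.val h))
    · exact absurd (by rw [key.1 h2]; exact a.2) h1
    · simp

theorem PIemb_injective : Function.Injective (PIemb F A) := by
  rw [injective_iff_map_eq_zero]
  intro x hx
  ext g
  let r : G ⧸ A := ((1 : G) : G ⧸ A)
  let q : G ⧸ A := ((g * r.out : G) : G ⧸ A)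
  have h1 : (q.out)⁻¹ * g * r.out ∈ A := (PI_mem_iff A g q r).2 rfl
  have := PIemb_coeff F A x q r ⟨_, h1⟩
  rw [hx] at this
  have e : q.out * ((q.out)⁻¹ * g * r.out) * (r.out)⁻¹ = g := by group
  simp only [e] at this
  rw [← this]; simp
end Embed

section Kernel
variable (F : Type*) [Field F] {G : Type*} [Group G]

/-- span of the elements `n - 1` -/
noncomputable def PIW (N : Subgroup G) : Submodule F (MonoidAlgebra F G) :=
  Submodule.span F {x | ∃ n ∈ N, x = MonoidAlgebra.single n 1 - 1}

theorem PIker (N : Subgroup G) [N.Normal] (x : MonoidAlgebra F G)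
    (hx : MonoidAlgebra.mapDomainAlgHom F F (QuotientGroup.mk' N) x = 0) :
    x ∈ (⊤ : Submodule F (MonoidAlgebra F G)) * PIW F N := by
  let S : MonoidAlgebra F (G ⧸ N) →ₗ[F] MonoidAlgebra F G :=
    MonoidAlgebra.mapDomainLinearMap F F (fun q : G ⧸ N => q.out)
  have key : ∀ y : MonoidAlgebra F G,
      y - S (MonoidAlgebra.mapDomainAlgHom F F (QuotientGroup.mk' N) y) ∈
        (⊤ : Submodule F (MonoidAlgebra F G)) * PIW F N := by
    intro y
    induction y using MonoidAlgebra.induction_linear with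
    | zero => simp
    | add x y hx hy =>
      rw [map_add, map_add, add_sub_add_comm]
      exact Submodule.add_mem _ hx hy
    | single g c =>
      have h1 : S (MonoidAlgebra.mapDomainAlgHom F F (QuotientGroup.mk' N)
          (MonoidAlgebra.single g c)) =
          MonoidAlgebra.single (((g : G ⧸ N)).out) c := by
        simp [S, MonoidAlgebra.mapDomain_single]
      rw [h1]
      set s := ((g : G ⧸ N)).out with hs
      have h2 : s⁻¹ * g ∈ N := by
        rw [← QuotientGroup.eq, hs, QuotientGroup.out_eq']
      have h3 : MonoidAlgebra.single g c - MonoidAlgebra.single s c =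
          MonoidAlgebra.single s c * (MonoidAlgebra.single (s⁻¹ * g) 1 - 1) := by
        rw [mul_sub, MonoidAlgebra.single_mul_single, mul_one, mul_one, mul_inv_cancel_left]
      rw [h3]
      exact Submodule.mul_mem_mul trivial (Submodule.subset_span ⟨_, h2, rfl⟩)
  have := key x
  rwa [hx, map_zero, sub_zero] at this

theorem PIW_top (N : Subgroup G) [hN : N.Normal] :
    PIW F N * ⊤ ≤ (⊤ : Submodule F (MonoidAlgebra F G)) * PIW F N := by
  rw [PIW, Submodule.mul_le]
  intro w hw y hy
  clear hy
  induction hw using Submodule.span_induction with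
  | zero => simp
  | add a b _ _ ha hb => rw [add_mul]; exact Submodule.add_mem _ ha hb
  | smul c a _ ha => rw [smul_mul_assoc]; exact Submodule.smul_mem _ _ ha
  | mem w hw =>
    obtain ⟨n, hn, rfl⟩ := hw
    induction y using MonoidAlgebra.induction_linear with
    | zero => simp
    | add a b ha hb => rw [mul_add]; exact Submodule.add_mem _ ha hb
    | single g c =>
      have : (MonoidAlgebra.single n 1 - 1) * MonoidAlgebra.single g c =
          MonoidAlgebra.single g c * (MonoidAlgebra.single (g⁻¹ * n * g) 1 - 1) := by
        rw [mul_sub, sub_mul, MonoidAlgebra.single_mul_single, MonoidAlgebra.single_mul_single,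
          mul_one, one_mul, mul_one, one_mul]
        congr 2; group
      rw [this]
      refine Submodule.mul_mem_mul trivial (Submodule.subset_span ⟨_, ?_, rfl⟩)
      simpa using hN.conj_mem n hn g⁻¹

theorem PIW_pow (N : Subgroup G) [hN : N.Normal] (k : ℕ) :
    ((⊤ : Submodule F (MonoidAlgebra F G)) * PIW F N) ^ k ≤ ⊤ * PIW F N ^ k := by
  induction k with
  | zero => rw [pow_zero, pow_zero, mul_one]; exact le_top
  | succ k ih =>
    have h : ∀ j, PIW F N ^ j * ⊤ ≤ (⊤ : Submodule F (MonoidAlgebra F G)) * PIW F N ^ j := by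
      intro j
      induction j with
      | zero => simp
      | succ j ih =>
        calc PIW F N ^ (j+1) * ⊤ = PIW F N ^ j * (PIW F N * ⊤) := by rw [pow_succ, mul_assoc]
          _ ≤ PIW F N ^ j * (⊤ * PIW F N) := by exact mul_le_mul_right (PIW_top F N) _
          _ = (PIW F N ^ j * ⊤) * PIW F N := by rw [mul_assoc]
          _ ≤ (⊤ * PIW F N ^ j) * PIW F N := by gcongr
          _ = _ := by rw [mul_assoc, pow_succ]
    calc ((⊤ : Submodule F (MonoidAlgebra F G)) * PIW F N) ^ (k+1)
        = (⊤ * PIW F N) ^ k * (⊤ * PIW F N) := pow_succ _ _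
      _ ≤ (⊤ * PIW F N ^ k) * (⊤ * PIW F N) := by gcongr
      _ = ⊤ * (PIW F N ^ k * ⊤) * PIW F N := by simp only [mul_assoc]
      _ ≤ ⊤ * (⊤ * PIW F N ^ k) * PIW F N := by
          rw [mul_assoc, mul_assoc (⊤ : Submodule F (MonoidAlgebra F G)) (⊤ * _)]
          exact mul_le_mul_right (mul_le_mul_left (h k) _) _
      _ = (⊤ * ⊤) * (PIW F N ^ k * PIW F N) := by simp only [mul_assoc]
      _ ≤ ⊤ * PIW F N ^ (k+1) := by rw [pow_succ]; gcongr; exact le_top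

theorem PImap_sub {H : Type*} [Group H] (f : G →* H) (n : G) :
    (MonoidAlgebra.mapDomainAlgHom F F f).toLinearMap (MonoidAlgebra.single n 1 - 1) =
      MonoidAlgebra.single (f n) 1 - 1 := by
  rw [map_sub]
  simp [MonoidAlgebra.mapDomain_single]

theorem PIW_map {H : Type*} [Group H] (f : G →* H) (N : Subgroup G) (k : ℕ) :
    (PIW F N ^ k).map (MonoidAlgebra.mapDomainAlgHom F F f).toLinearMap = PIW F (N.map f) ^ k := by
  rw [Submodule.map_pow, PIW, Submodule.map_span]
  congr 2
  ext x
  constructor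
  · rintro ⟨_, ⟨n, hn, rfl⟩, rfl⟩
    exact ⟨f n, ⟨n, hn, rfl⟩, PImap_sub F f n⟩
  · rintro ⟨_, ⟨n, hn, rfl⟩, rfl⟩
    exact ⟨_, ⟨n, hn, rfl⟩, PImap_sub F f n⟩
end Kernel

theorem PIW_nilp (F : Type*) [Field F] (p : ℕ) [hp : Fact p.Prime] [CharP F p] (k : ℕ) :
    ∀ (P : Type*) [Group P] [Finite P], Nat.card P = p ^ k →
      PIW F (⊤ : Subgroup P) ^ (p ^ k) = ⊥ := by
  induction k with
  | zero =>
    intro P _ _ hP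
    rw [pow_zero] at hP ⊢
    rw [pow_one, PIW, Submodule.span_eq_bot]
    rintro _ ⟨n, -, rfl⟩
    have := (Nat.card_eq_one_iff_unique.1 hP).1
    rw [Subsingleton.elim n 1, ← MonoidAlgebra.one_def, sub_self]
  | succ k ih =>
    intro P _ _ hP
    have hPg : IsPGroup p P := IsPGroup.of_card hP
    have : Nontrivial P := by
      rw [← Finite.one_lt_card_iff_nontrivial, hP]
      exact Nat.one_lt_pow (by simp) hp.out.one_lt
    have hcn := hPg.center_nontrivial
    have hpc : p ∣ Nat.card (Subgroup.center P) := by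
      obtain ⟨n, hn, hcard⟩ := (hPg.to_subgroup (Subgroup.center P)).nontrivial_iff_card.1 hcn
      rw [hcard]; exact dvd_pow_self p hn.ne'
    obtain ⟨z', hz'⟩ := exists_prime_orderOf_dvd_card' p hpc
    set z : P := (z' : P) with hzdef
    have hz : orderOf z = p := by rw [hzdef, Subgroup.orderOf_coe, hz']
    have hzc : ∀ g : P, g * z = z * g := Subgroup.mem_center_iff.1 z'.2
    let Z := Subgroup.zpowers z
    have hZn : Z.Normal := by
      refine ⟨fun x hx g => ?_⟩
      have hxc : x ∈ Subgroup.center P := by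
        have : Z ≤ Subgroup.center P := by
          rw [Subgroup.zpowers_le]; exact z'.2
        exact this hx
      rw [Subgroup.mem_center_iff.1 hxc g, mul_inv_cancel_right]
      exact hx
    have hZcard : Nat.card Z = p := by rw [Nat.card_zpowers, hz]
    have hQ : Nat.card (P ⧸ Z) = p ^ k := by
      have h1 := Subgroup.card_eq_card_quotient_mul_card_subgroup Z
      rw [hP, hZcard, pow_succ] at h1
      exact (Nat.eq_of_mul_eq_mul_right hp.out.pos h1).symm
    have h2 := ih (P ⧸ Z) hQ
    have h3 := PIW_map F (QuotientGroup.mk' Z) ⊤ (p ^ k)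
    rw [Subgroup.map_top_of_surjective _ (QuotientGroup.mk'_surjective Z), h2] at h3
    have h3' : ∀ x ∈ PIW F (⊤ : Subgroup P) ^ (p ^ k),
        MonoidAlgebra.mapDomainAlgHom F F (QuotientGroup.mk' Z) x = 0 := by
      intro x hx
      have := Submodule.mem_map_of_mem
        (f := (MonoidAlgebra.mapDomainAlgHom F F (QuotientGroup.mk' Z)).toLinearMap) hx
      rw [h3] at this
      exact (Submodule.mem_bot F).1 this
    set w : MonoidAlgebra F P := MonoidAlgebra.single z 1 - 1 with hw
    have hwc : ∀ x, x * w = w * x := by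
      intro x
      rw [hw, mul_sub, sub_mul, mul_one, one_mul]
      congr 1
      induction x using MonoidAlgebra.induction_linear with
      | zero => simp
      | add a b ha hb => rw [add_mul, mul_add, ha, hb]
      | single g c => simp [hzc]
    have hwp : w ^ p = 0 := by
      have : CharP (MonoidAlgebra F P) p := charP_of_injective_algebraMap
        (algebraMap F (MonoidAlgebra F P)).injective p
      rw [hw, sub_pow_char_of_commute p (Commute.one_right (MonoidAlgebra.single z (1 : F))), one_pow, MonoidAlgebra.single_pow,
        ← hz, pow_orderOf_eq_one, one_pow, ← MonoidAlgebra.one_def, sub_self]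
    have h4 : PIW F (⊤ : Subgroup P) ^ (p ^ k) ≤ Submodule.span F {w} * ⊤ := by
      intro x hx
      have h5 := PIker F Z x (h3' x hx)
      refine (Submodule.mul_le (P := Submodule.span F {w} * ⊤)).2 ?_ h5
      intro y _ v hv
      rw [PIW] at hv
      induction hv using Submodule.span_induction with
      | zero => simp
      | add a b _ _ ha hb => rw [mul_add]; exact Submodule.add_mem _ ha hb
      | smul c a _ ha => rw [mul_smul_comm]; exact Submodule.smul_mem _ _ ha
      | mem v hv =>
        obtain ⟨n, hn, rfl⟩ := hv
        obtain ⟨i, rfl⟩ : ∃ i : ℕ, z ^ i = n :=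
          mem_powers_iff_mem_zpowers.2 hn
        have h6 : (MonoidAlgebra.single (z ^ i) 1 - 1 : MonoidAlgebra F P) =
            w * ∑ j ∈ Finset.range i, (MonoidAlgebra.single z 1) ^ j := by
          rw [hw, mul_geom_sum, MonoidAlgebra.single_pow, one_pow]
        rw [h6, ← mul_assoc, hwc, mul_assoc]
        exact Submodule.mul_mem_mul (Submodule.mem_span_singleton_self w) trivial
    have hcomm : (⊤ : Submodule F (MonoidAlgebra F P)) * Submodule.span F {w} ≤
        Submodule.span F {w} * ⊤ := by
      rw [Submodule.mul_le]
      intro y _ v hv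
      obtain ⟨c, rfl⟩ := Submodule.mem_span_singleton.1 hv
      rw [mul_smul_comm, hwc, ← smul_mul_assoc]
      exact Submodule.mul_mem_mul hv trivial
    have h7 : ∀ j, (Submodule.span F {w} * (⊤ : Submodule F (MonoidAlgebra F P))) ^ j ≤
        Submodule.span F {w} ^ j * ⊤ := by
      intro j
      induction j with
      | zero => simp
      | succ j ihj =>
        calc (Submodule.span F {w} * (⊤ : Submodule F (MonoidAlgebra F P))) ^ (j+1)
            = (Submodule.span F {w} * ⊤) ^ j * (Submodule.span F {w} * ⊤) := pow_succ _ _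
          _ ≤ (Submodule.span F {w} ^ j * ⊤) * (Submodule.span F {w} * ⊤) := by gcongr
          _ = Submodule.span F {w} ^ j * (⊤ * Submodule.span F {w}) * ⊤ := by simp only [mul_assoc]
          _ ≤ Submodule.span F {w} ^ j * (Submodule.span F {w} * ⊤) * ⊤ := by gcongr
          _ = Submodule.span F {w} ^ (j+1) * (⊤ * ⊤) := by rw [pow_succ]; simp only [mul_assoc]
          _ ≤ _ := by gcongr; exact le_top
    rw [pow_succ, pow_mul, eq_bot_iff]
    calc (PIW F (⊤ : Subgroup P) ^ (p ^ k)) ^ p ≤ (Submodule.span F {w} * ⊤) ^ p := by gcongr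
      _ ≤ Submodule.span F {w} ^ p * ⊤ := h7 p
      _ = ⊥ := by rw [Submodule.span_pow]; simp [hwp]

/-- the kernel ideal is nilpotent -/
theorem PIker_nilp (F : Type*) [Field F] (p : ℕ) [hp : Fact p.Prime] [CharP F p] (k : ℕ)
    (G : Type*) [Group G] (N : Subgroup G) [N.Normal] [Finite N] (hN : Nat.card N = p ^ k) :
    ((⊤ : Submodule F (MonoidAlgebra F G)) * PIW F N) ^ (p ^ k) = ⊥ := by
  have h := PIW_nilp F p k N hN
  have h1 := PIW_map F N.subtype ⊤ (p ^ k)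
  rw [h, Submodule.map_bot, ← MonoidHom.range_eq_map, Subgroup.range_subtype] at h1
  have := PIW_pow F N (p ^ k)
  rw [← h1, Submodule.mul_bot] at this
  exact eq_bot_iff.2 this

theorem PI_AL' {n : Type*} [Fintype n] [DecidableEq n] {R : Type*} [Ring R]
    (hc : ∀ x y : R, x * y = y * x) (A : Fin (2 * Fintype.card n) → Matrix n n R) :
    PIstd A = 0 := by
  letI : CommRing R := { ‹Ring R› with mul_comm := hc }
  exact PI_AL A

theorem PI_comm (F : Type*) [Field F] {H : Type*} [Group H] (hH : ∀ a b : H, a * b = b * a)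
    (x y : MonoidAlgebra F H) : x * y = y * x := by
  induction x using MonoidAlgebra.induction_linear with
  | zero => simp
  | add a b ha hb => rw [add_mul, mul_add, ha, hb]
  | single g c =>
    induction y using MonoidAlgebra.induction_linear with
    | zero => simp
    | add a b ha hb => rw [add_mul, mul_add, ha, hb]
    | single g' c' =>
      rw [MonoidAlgebra.single_mul_single, MonoidAlgebra.single_mul_single, hH, mul_comm c]

theorem PIstd_free_ne (F : Type*) [Field F] (N : ℕ) :
    PIstd (FreeAlgebra.ι F : Fin N → FreeAlgebra F (Fin N)) ≠ 0 := by
  intro h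
  have h1 := congrArg (FreeAlgebra.equivMonoidAlgebraFreeMonoid (R := F) (X := Fin N)) h
  have h2 := PIstd_map
    (FreeAlgebra.equivMonoidAlgebraFreeMonoid (R := F) (X := Fin N)).toAlgHom.toRingHom
    (FreeAlgebra.ι F : Fin N → FreeAlgebra F (Fin N))
  have h3 : PIstd (fun i : Fin N => (MonoidAlgebra.single (FreeMonoid.of i) 1 :
      MonoidAlgebra F (FreeMonoid (Fin N)))) = 0 := by
    rw [map_zero] at h1
    refine Eq.trans ?_ (h2.symm.trans h1)
    congr 1
    ext1 i
    simp [FreeAlgebra.equivMonoidAlgebraFreeMonoid]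
  have hl : ∀ l : List (Fin N), (l.map fun i => (MonoidAlgebra.single (FreeMonoid.of i) 1 :
      MonoidAlgebra F (FreeMonoid (Fin N)))).prod = MonoidAlgebra.single (FreeMonoid.ofList l) 1 := by
    intro l
    induction l with
    | nil => rfl
    | cons a l ih =>
      rw [List.map_cons, List.prod_cons, ih, MonoidAlgebra.single_mul_single, mul_one,
        FreeMonoid.ofList_cons]
  have h4 : ∀ σ : Equiv.Perm (Fin N), (List.ofFn fun i =>
      (MonoidAlgebra.single (FreeMonoid.of (σ i)) 1 :
        MonoidAlgebra F (FreeMonoid (Fin N)))).prod =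
      MonoidAlgebra.single (FreeMonoid.ofList (List.ofFn σ)) 1 := by
    intro σ
    rw [← hl, List.map_ofFn]; rfl
  simp only [PIstd, h4] at h3
  have h5 := congrArg (fun x => x.coeff (FreeMonoid.ofList (List.ofFn (1 : Equiv.Perm (Fin N))))) h3
  classical
  simp only [MonoidAlgebra.coeff_sum, Finsupp.finsetSum_apply] at h5
  rw [Finset.sum_eq_single 1] at h5
  · simp at h5
  · intro σ _ hσ
    rw [MonoidAlgebra.coeff_smul_apply, MonoidAlgebra.coeff_single, Finsupp.single_apply, if_neg,
      smul_zero]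
    intro he
    apply hσ
    have := List.ofFn_injective (FreeMonoid.ofList.injective he)
    exact DFunLike.coe_injective this
  · simp

theorem PI_matrix_pow {F R n : Type*} [Field F] [Ring R] [Algebra F R] [Fintype n] [DecidableEq n]
    (I : Submodule F R) (M : Matrix n n R) (hM : ∀ a b, M a b ∈ I) (k : ℕ) :
    ∀ a b, (M ^ (k + 1)) a b ∈ I ^ (k + 1) := by
  induction k with
  | zero => simpa using hM
  | succ k ih =>
    intro a b
    rw [pow_succ M, pow_succ I (k + 1), Matrix.mul_apply]
    exact Submodule.sum_mem _ fun c _ => Submodule.mul_mem_mul (ih a c) (hM c b)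

/-- If `G` has a subgroup `A` of finite index `m` with `[A,A]` trivial
(char 0 case) or `[A,A]` a finite `p`-group of order `p^k` with `char F = p > 0`,
then `F[G]` satisfies a nontrivial polynomial identity; in the abelian case
`F[G]` satisfies `s_{2m} = 0`, and in the `p`-abelian case `F[A]` satisfies
`[x,y]^{p^k} = 0`. -/
theorem stmt_17 (F : Type*) [Field F] (G : Type*) [Group G]
    (A : Subgroup G) (m : ℕ) (hm0 : 0 < m) (hm : A.index = m) :
    ((∀ a b : G, a ∈ A → b ∈ A → a * b = b * a) →
      ((∀ h : Fin (2 * m) → MonoidAlgebra F G,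
          ∑ σ : Equiv.Perm (Fin (2 * m)),
            (Equiv.Perm.sign σ : ℤ) • (List.ofFn fun i => h (σ i)).prod = 0) ∧
        ∃ (r : ℕ) (f : FreeAlgebra F (Fin r)), f ≠ 0 ∧
          ∀ g : Fin r → MonoidAlgebra F G, FreeAlgebra.lift F g f = 0)) ∧
    (∀ p k : ℕ, p.Prime → ringChar F = p →
      Nat.card ↥(commutator ↥A) = p ^ k → Finite ↥(commutator ↥A) →
      ((∀ u v : MonoidAlgebra F ↥A, (u * v - v * u) ^ (p ^ k) = 0) ∧
        ∃ (r : ℕ) (f : FreeAlgebra F (Fin r)), f ≠ 0 ∧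
          ∀ g : Fin r → MonoidAlgebra F G, FreeAlgebra.lift F g f = 0)) := by
  classical
  have hfin : Finite (G ⧸ A) := by
    apply Nat.finite_of_card_ne_zero
    change A.index ≠ 0
    omega
  letI : Fintype (G ⧸ A) := Fintype.ofFinite _
  have hm' : Fintype.card (G ⧸ A) = m := by
    rw [← hm, Subgroup.index, Nat.card_eq_fintype_card]
  subst hm'
  have hlift : ∀ g : Fin (2 * Fintype.card (G ⧸ A)) → MonoidAlgebra F G,
      FreeAlgebra.lift F g (PIstd (FreeAlgebra.ι F)) = PIstd g := by
    intro g
    refine (PIstd_map (FreeAlgebra.lift F g).toRingHom _).trans ?_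
    congr 1
    ext1 i
    exact FreeAlgebra.lift_ι_apply g i
  refine ⟨fun hab => ?_, fun p k hp hchar hcard hfinN => ?_⟩
  · have hstd : ∀ h : Fin (2 * Fintype.card (G ⧸ A)) → MonoidAlgebra F G, PIstd h = 0 := by
      intro h
      apply PIemb_injective F A
      rw [map_zero]
      refine (PIstd_map (PIemb F A).toRingHom h).trans ?_
      exact PI_AL' (PI_comm F fun a b => Subtype.ext (hab a b a.2 b.2)) _
    exact ⟨hstd, _, _, PIstd_free_ne F _, fun g => (hlift g).trans (hstd g)⟩
  · haveI : Fact p.Prime := ⟨hp⟩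
    haveI : CharP F p := hchar ▸ ringChar.charP F
    let φ := MonoidAlgebra.mapDomainAlgHom F F (QuotientGroup.mk' (commutator A))
    have hc : ∀ x y : MonoidAlgebra F (A ⧸ commutator A), x * y = y * x :=
      PI_comm F (mul_comm (G := Abelianization A))
    let I : Submodule F (MonoidAlgebra F A) := ⊤ * PIW F (commutator A)
    have hI : I ^ (p ^ k) = ⊥ := PIker_nilp F p k A (commutator A) hcard
    have hker : ∀ x, φ x = 0 → x ∈ I := PIker F (commutator A)
    refine ⟨fun u v => ?_, _, PIstd (FreeAlgebra.ι F) ^ (p ^ k),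
      pow_ne_zero _ (PIstd_free_ne F (2 * Fintype.card (G ⧸ A))), fun g => ?_⟩
    · have h1 : u * v - v * u ∈ I := by
        apply hker
        rw [map_sub, map_mul, map_mul, hc, sub_self]
      have h2 := Submodule.pow_mem_pow I h1 (p ^ k)
      rw [hI] at h2
      exact (Submodule.mem_bot F).1 h2
    · rw [map_pow, hlift]
      apply PIemb_injective F A
      rw [map_zero, map_pow]
      have h1 : φ.toRingHom.mapMatrix (PIemb F A (PIstd g)) = 0 := by
        refine (PIstd_map (φ.toRingHom.mapMatrix.comp (PIemb F A).toRingHom) g).trans ?_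
        exact PI_AL' hc _
      have h2 : ∀ a b, PIemb F A (PIstd g) a b ∈ I := fun a b =>
        hker _ (congrFun (congrFun h1 a) b)
      have h3 := PI_matrix_pow I _ h2 (p ^ k - 1)
      rw [Nat.sub_add_cancel (Nat.pos_of_ne_zero (pow_ne_zero _ hp.ne_zero)), hI] at h3
      ext1 a b
      exact (Submodule.mem_bot F).1 (h3 a b)
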